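/- Let $V$ be a separable Hilbert space, $H\in(1/2,1)$, $-\infty\le\alpha<\beta\le\infty$, and let $f(t,x,\theta)$ be a $V$-valued function on $\mathbb{R}\times\mathbb{R}^d\times(\alpha,\beta)$, jointly measurable, infinitely differentiable with compact support in $(t,x)$ (as a function with values in $L^{1/H}((\alpha,\beta);V)$), and suppose $f(t,x,\theta)=0$ whenever $t\ge-8$. Then for every $(t,x)\in Q_0$: $\int_{Q_0}|\mathcal{G}f(s,y)-\mathcal{G}f(t,x)|^2\,ds\,dy\;\le\;N\,\mathbb{M}_t\big[F_f(\cdot,x)\big](t),$ where $N$ depends only on $d$ and $F_f(t,x):=\left(\int_\alpha^\beta\big(\mathbb{M}_x[\|f(t,\cdot,\theta)\|_V^2](x)\big)^{1/(2H)}\,d\theta\right)^{2H}$. -/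

import Mathlib

open MeasureTheory ENNReal

/-- The heat kernel `G_t(x) = (4πt)^{-d/2} exp(-|x|²/(4t))` on `ℝ^d`. -/
noncomputable def heatKernel (d : ℕ) (t : ℝ) (x : EuclideanSpace ℝ (Fin d)) : ℝ :=
  (4 * Real.pi * t) ^ (-(d : ℝ)/2) * Real.exp (-‖x‖^2 / (4*t))

/-- The heat semigroup `T_t h (x) = ∫_{ℝ^d} h(x-y) G_t(y) dy` (Bochner integral). -/
noncomputable def heatOp (d : ℕ) {V : Type*} [NormedAddCommGroup V] [NormedSpace ℝ V]
    [CompleteSpace V] (t : ℝ) (h : EuclideanSpace ℝ (Fin d) → V)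
    (x : EuclideanSpace ℝ (Fin d)) : V :=
  ∫ y, heatKernel d t y • h (x - y)

/-- Squared norm of the spatial gradient of `T_t h` at `x`:
`‖∇ T_t h(x)‖² = ∑_{j=1}^d ‖∂_{x_j} T_t h(x)‖²`. -/
noncomputable def gradHeatNormSq (d : ℕ) {V : Type*} [NormedAddCommGroup V]
    [NormedSpace ℝ V] [CompleteSpace V] (t : ℝ) (h : EuclideanSpace ℝ (Fin d) → V)
    (x : EuclideanSpace ℝ (Fin d)) : ℝ :=
  ∑ j : Fin d, ‖fderiv ℝ (heatOp d t h) x (EuclideanSpace.single j 1)‖^2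

/-- The square-function operator
`𝒢f(t,x) = [∫_{-∞}^t (∫_α^β ‖∇T_{t-s}f(s,·,θ)(x)‖^{1/H} dθ)^{2H} ds]^{1/2}`
(note `‖∇T_{t-s}f(s,·,θ)(x)‖^{1/H} = (gradHeatNormSq ...)^{1/(2H)}`). -/
noncomputable def calG (d : ℕ) {V : Type*} [NormedAddCommGroup V] [NormedSpace ℝ V]
    [CompleteSpace V] (H : ℝ) (α β : EReal)
    (f : ℝ → EuclideanSpace ℝ (Fin d) → ℝ → V)
    (t : ℝ) (x : EuclideanSpace ℝ (Fin d)) : ℝ :=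
  (∫ s in Set.Iio t,
      (∫ θ in {θ : ℝ | α < (θ : EReal) ∧ (θ : EReal) < β},
        (gradHeatNormSq d (t - s) (fun y => f s y θ) x) ^ (1/(2*H))) ^ (2*H))
    ^ ((1:ℝ)/2)

/-- Hardy–Littlewood maximal function over balls in `ℝ^d`:
`𝕄_x g(x) = sup_{r>0} |B_r|⁻¹ ∫_{B_r(x)} |g(y)| dy`. -/
noncomputable def maxX (d : ℕ) (g : EuclideanSpace ℝ (Fin d) → ℝ)
    (x : EuclideanSpace ℝ (Fin d)) : ℝ≥0∞ :=
  ⨆ (r : ℝ) (_ : 0 < r),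
    (volume (Metric.ball x r))⁻¹ * ∫⁻ y in Metric.ball x r, ENNReal.ofReal |g y|

/-- Hardy–Littlewood maximal function over intervals in `ℝ`:
`𝕄_t k(t) = sup_{r>0} (2r)⁻¹ ∫_{t-r}^{t+r} |k(s)| ds`. -/
noncomputable def maxT (k : ℝ → ℝ≥0∞) (t : ℝ) : ℝ≥0∞ :=
  ⨆ (r : ℝ) (_ : 0 < r),
    (ENNReal.ofReal (2*r))⁻¹ * ∫⁻ s in Set.Ioo (t - r) (t + r), k s

/-- `F_f(t,x) = (∫_α^β (𝕄_x[‖f(t,·,θ)‖²](x))^{1/(2H)} dθ)^{2H}`. -/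
noncomputable def Ff (d : ℕ) {V : Type*} [NormedAddCommGroup V] (H : ℝ) (α β : EReal)
    (f : ℝ → EuclideanSpace ℝ (Fin d) → ℝ → V)
    (t : ℝ) (x : EuclideanSpace ℝ (Fin d)) : ℝ≥0∞ :=
  (∫⁻ θ in {θ : ℝ | α < (θ : EReal) ∧ (θ : EReal) < β},
      (maxX d (fun y => ‖f t y θ‖^2) x) ^ (1/(2*H))) ^ (2*H)

/-- The cube `Q₀ = [-4,0] × [-1,1]^d ⊆ ℝ^{d+1}`. -/
def cubeQ0 (d : ℕ) : Set (ℝ × EuclideanSpace ℝ (Fin d)) :=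
  Set.Icc (-4 : ℝ) 0 ×ˢ {x | ∀ j, x j ∈ Set.Icc (-1 : ℝ) 1}

/-- Total mass of a translated Gaussian. -/
lemma lintegral_exp_neg_mul_sq_norm_sub (d : ℕ) {b : ℝ} (hb : 0 < b)
    (x : EuclideanSpace ℝ (Fin d)) :
    ∫⁻ z, ENNReal.ofReal (Real.exp (-b * ‖x - z‖ ^ 2)) =
      ENNReal.ofReal ((Real.pi / b) ^ ((d : ℝ) / 2)) := by
  have h := GaussianFourier.integral_rexp_neg_mul_sq_norm (V := EuclideanSpace ℝ (Fin d)) hb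
  have hint : Integrable fun v : EuclideanSpace ℝ (Fin d) => Real.exp (-b * ‖v‖ ^ 2) := by
    by_contra hc
    rw [integral_undef hc] at h
    have : 0 < (Real.pi / b) ^ ((Module.finrank ℝ (EuclideanSpace ℝ (Fin d)) : ℝ) / 2) := by
      positivity
    exact this.ne h
  rw [lintegral_sub_left_eq_self (fun z => ENNReal.ofReal (Real.exp (-b * ‖z‖ ^ 2))) x,
    ← ofReal_integral_eq_lintegral_ofReal hint (ae_of_all _ fun _ => (Real.exp_pos _).le), h,
    finrank_euclideanSpace_fin]

/-- A Gaussian average is controlled by any bound for the averages over balls. -/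
lemma lintegral_exp_neg_mul_sq_norm_sub_mul_le (d : ℕ) {b : ℝ} (hb : 0 < b)
    (x : EuclideanSpace ℝ (Fin d)) {g : EuclideanSpace ℝ (Fin d) → ℝ≥0∞} (hg : Measurable g)
    (M : ℝ≥0∞) (hM : ∀ r, 0 < r → ∫⁻ z in Metric.ball x r, g z ≤ volume (Metric.ball x r) * M) :
    ∫⁻ z, ENNReal.ofReal (Real.exp (-b * ‖x - z‖ ^ 2)) * g z ≤
      ENNReal.ofReal ((Real.pi / b) ^ ((d : ℝ) / 2)) * M := by
  have hcont : Continuous fun z => Real.exp (-b * ‖x - z‖ ^ 2) := by fun_prop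
  have hm : Measurable fun z => ENNReal.ofReal (Real.exp (-b * ‖x - z‖ ^ 2)) :=
    hcont.measurable.ennreal_ofReal
  have hsuper : ∀ t ∈ Set.Ioi (0 : ℝ),
      (volume.withDensity g) {z | t < Real.exp (-b * ‖x - z‖ ^ 2)} ≤
        volume {z | t < Real.exp (-b * ‖x - z‖ ^ 2)} * M := by
    intro t ht
    have ht : 0 < t := ht
    have hmem : ∀ z, t < Real.exp (-b * ‖x - z‖ ^ 2) ↔ ‖x - z‖ ^ 2 < -Real.log t / b := by
      intro z
      rw [← Real.log_lt_iff_lt_exp ht, lt_div_iff₀ hb]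
      constructor <;> intro h <;> linarith
    rcases le_or_gt (-Real.log t / b) 0 with h0 | h0
    · have : {z | t < Real.exp (-b * ‖x - z‖ ^ 2)} = ∅ := by
        ext z
        simp only [Set.mem_ofPred_eq, hmem, Set.mem_empty_iff_false, iff_false, not_lt]
        exact h0.trans (sq_nonneg _)
      rw [this]; simp
    · have : {z | t < Real.exp (-b * ‖x - z‖ ^ 2)} =
          Metric.ball x (Real.sqrt (-Real.log t / b)) := by
        ext z
        rw [Set.mem_ofPred_eq, hmem, Metric.mem_ball, dist_comm, dist_eq_norm,
          Real.lt_sqrt (norm_nonneg _)]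
      rw [this, withDensity_apply _ Metric.isOpen_ball.measurableSet]
      exact hM _ (Real.sqrt_pos.2 h0)
  calc ∫⁻ z, ENNReal.ofReal (Real.exp (-b * ‖x - z‖ ^ 2)) * g z
      = ∫⁻ z, ENNReal.ofReal (Real.exp (-b * ‖x - z‖ ^ 2)) ∂(volume.withDensity g) := by
        rw [lintegral_withDensity_eq_lintegral_mul _ hg hm]
        simp only [Pi.mul_apply, mul_comm]
    _ = ∫⁻ t in Set.Ioi 0, (volume.withDensity g) {z | t < Real.exp (-b * ‖x - z‖ ^ 2)} :=
        lintegral_eq_lintegral_meas_lt _ (ae_of_all _ fun _ => (Real.exp_pos _).le)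
          hcont.measurable.aemeasurable
    _ ≤ ∫⁻ t in Set.Ioi 0, volume {z | t < Real.exp (-b * ‖x - z‖ ^ 2)} * M :=
        setLIntegral_mono' measurableSet_Ioi hsuper
    _ = (∫⁻ t in Set.Ioi 0, volume {z | t < Real.exp (-b * ‖x - z‖ ^ 2)}) * M := by
        refine lintegral_mul_const _ (Antitone.measurable fun s t hst => ?_)
        exact measure_mono fun z (hz : t < _) => lt_of_le_of_lt hst hz
    _ = ENNReal.ofReal ((Real.pi / b) ^ ((d : ℝ) / 2)) * M := by
        rw [← lintegral_eq_lintegral_meas_lt _ (ae_of_all _ fun _ => (Real.exp_pos _).le)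
          hcont.measurable.aemeasurable, lintegral_exp_neg_mul_sq_norm_sub d hb]

lemma lintegral_ball_le_mul_maxX (d : ℕ) (g : EuclideanSpace ℝ (Fin d) → ℝ)
    (x : EuclideanSpace ℝ (Fin d)) {r : ℝ} (hr : 0 < r) :
    ∫⁻ z in Metric.ball x r, ENNReal.ofReal |g z| ≤ volume (Metric.ball x r) * maxX d g x := by
  have h0 : volume (Metric.ball x r) ≠ 0 := (Metric.measure_ball_pos _ _ hr).ne'
  have ht : volume (Metric.ball x r) ≠ ∞ := measure_ball_lt_top.ne
  rw [← ENNReal.inv_mul_le_iff h0 ht]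
  exact le_iSup₂ (f := fun (r : ℝ) (_ : 0 < r) =>
    (volume (Metric.ball x r))⁻¹ * ∫⁻ y in Metric.ball x r, ENNReal.ofReal |g y|) r hr

lemma lintegral_Ioo_le_mul_maxT (k : ℝ → ℝ≥0∞) (t : ℝ) {r : ℝ} (hr : 0 < r) :
    ∫⁻ s in Set.Ioo (t - r) (t + r), k s ≤ ENNReal.ofReal (2 * r) * maxT k t := by
  have h0 : ENNReal.ofReal (2 * r) ≠ 0 := by simpa using hr
  rw [← ENNReal.inv_mul_le_iff h0 ENNReal.ofReal_ne_top]
  exact le_iSup₂ (f := fun (r : ℝ) (_ : 0 < r) =>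
    (ENNReal.ofReal (2*r))⁻¹ * ∫⁻ s in Set.Ioo (t - r) (t + r), k s) r hr

/-- Integration against a kernel with Gaussian decay is controlled by the maximal function. -/
lemma enorm_integral_smul_sq_le_maxX (d : ℕ) {V : Type*} [NormedAddCommGroup V]
    [NormedSpace ℝ V] {h : EuclideanSpace ℝ (Fin d) → V} (hh : Continuous h)
    (x : EuclideanSpace ℝ (Fin d)) {k : EuclideanSpace ℝ (Fin d) → ℝ} {A ρ : ℝ} (hA : 0 ≤ A)
    (hρ : 0 < ρ)
    (hk : ∀ z, |k z| ≤ A * (ρ ^ (-(d : ℝ) / 2) * Real.exp (-‖x - z‖ ^ 2 / (16 * ρ)))) :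
    ‖∫ z, k z • h z‖ₑ ^ 2 ≤
      ENNReal.ofReal (A ^ 2 * (16 * Real.pi) ^ d) * maxX d (fun z => ‖h z‖ ^ 2) x := by
  set M := maxX d (fun z => ‖h z‖ ^ 2) x with hMdef
  set b : ℝ := 1 / (16 * ρ) with hbdef
  have hb : 0 < b := by positivity
  set e : EuclideanSpace ℝ (Fin d) → ℝ≥0∞ :=
    fun z => ENNReal.ofReal (Real.exp (-b * ‖x - z‖ ^ 2)) with he
  have hem : Measurable e := by
    refine Measurable.ennreal_ofReal (Continuous.measurable ?_); fun_prop
  set B : ℝ := A * ρ ^ (-(d : ℝ) / 2) with hBdef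
  have hB : 0 ≤ B := by positivity
  set m : ℝ := (Real.pi / b) ^ ((d : ℝ) / 2) with hmdef
  have hm0 : 0 ≤ m := by positivity
  have hnm : Measurable fun z => ‖h z‖ₑ := hh.enorm.measurable
  have h1 : ‖∫ z, k z • h z‖ₑ ≤ ENNReal.ofReal B * ∫⁻ z, e z * ‖h z‖ₑ := by
    rw [← lintegral_const_mul (μ := volume) _ (f := fun z => e z * ‖h z‖ₑ) (hem.mul hnm)]
    refine (enorm_integral_le_lintegral_enorm _).trans (lintegral_mono fun z => ?_)
    rw [enorm_smul, ← mul_assoc, he, ← ENNReal.ofReal_mul hB]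
    gcongr
    rw [Real.enorm_eq_ofReal_abs]
    refine ENNReal.ofReal_le_ofReal ((hk z).trans (le_of_eq ?_))
    rw [hBdef, hbdef, mul_assoc]
    congr 3
    field_simp
  have hconj : (2 : ℝ).HolderConjugate 2 := Real.HolderConjugate.two_two
  have h2 : (∫⁻ z, e z * ‖h z‖ₑ) ^ 2 ≤ ENNReal.ofReal m * ∫⁻ z, e z * ‖h z‖ₑ ^ 2 := by
    have hH := ENNReal.lintegral_mul_le_Lp_mul_Lq (volume.withDensity e) hconj
      (f := fun _ => 1) (g := fun z => ‖h z‖ₑ) aemeasurable_const hnm.aemeasurable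
    have e1 : ∫⁻ z, ((fun _ => 1 : EuclideanSpace ℝ (Fin d) → ℝ≥0∞) * fun z => ‖h z‖ₑ) z
        ∂(volume.withDensity e) = ∫⁻ z, e z * ‖h z‖ₑ := by
      simp only [Pi.mul_apply, one_mul]
      rw [lintegral_withDensity_eq_lintegral_mul _ hem hnm]; rfl
    have e2 : ∫⁻ z, (1 : ℝ≥0∞) ^ (2 : ℝ) ∂(volume.withDensity e) = ENNReal.ofReal m := by
      simp only [ENNReal.one_rpow]
      rw [lintegral_withDensity_eq_lintegral_mul _ hem measurable_const, hmdef,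
        ← lintegral_exp_neg_mul_sq_norm_sub d hb x]
      simp [he]
    have e3 : ∫⁻ z, ‖h z‖ₑ ^ (2 : ℝ) ∂(volume.withDensity e) = ∫⁻ z, e z * ‖h z‖ₑ ^ 2 := by
      simp only [ENNReal.rpow_two]
      rw [lintegral_withDensity_eq_lintegral_mul _ hem (hnm.pow_const 2)]; rfl
    rw [e1, e2, e3] at hH
    calc (∫⁻ z, e z * ‖h z‖ₑ) ^ 2
        ≤ (ENNReal.ofReal m ^ (1 / (2 : ℝ)) *
            (∫⁻ z, e z * ‖h z‖ₑ ^ 2) ^ (1 / (2 : ℝ))) ^ 2 := by gcongr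
      _ = _ := by
          rw [mul_pow, ← ENNReal.rpow_two, ← ENNReal.rpow_mul, ← ENNReal.rpow_two,
            ← ENNReal.rpow_mul]
          norm_num
  have h3 : ∫⁻ z, e z * ‖h z‖ₑ ^ 2 ≤ ENNReal.ofReal m * M := by
    refine lintegral_exp_neg_mul_sq_norm_sub_mul_le d hb x (hnm.pow_const 2) M fun r hr => ?_
    refine le_trans (le_of_eq ?_) (lintegral_ball_le_mul_maxX d (fun z => ‖h z‖ ^ 2) x hr)
    refine lintegral_congr fun z => ?_
    rw [abs_of_nonneg (by positivity), ENNReal.ofReal_pow (norm_nonneg _), ofReal_norm]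
  have hBm : B * m = A * (16 * Real.pi) ^ ((d : ℝ) / 2) := by
    rw [hBdef, hmdef, hbdef, mul_assoc]
    congr 1
    rw [show Real.pi / (1 / (16 * ρ)) = ρ * (16 * Real.pi) by field_simp,
      Real.mul_rpow hρ.le (by positivity), ← mul_assoc, ← Real.rpow_add hρ]
    rw [show -(d : ℝ) / 2 + (d : ℝ) / 2 = 0 by ring]
    simp
  calc ‖∫ z, k z • h z‖ₑ ^ 2 ≤ (ENNReal.ofReal B * ∫⁻ z, e z * ‖h z‖ₑ) ^ 2 := by gcongr
    _ ≤ ENNReal.ofReal B ^ 2 * (ENNReal.ofReal m * (ENNReal.ofReal m * M)) := by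
        rw [mul_pow]; gcongr; exact h2.trans (by gcongr)
    _ = ENNReal.ofReal ((B * m) ^ 2) * M := by
        rw [ENNReal.ofReal_pow (by positivity), ENNReal.ofReal_mul hB]; ring
    _ = ENNReal.ofReal (A ^ 2 * (16 * Real.pi) ^ d) * M := by
        have h16 : ((16 * Real.pi) ^ ((d : ℝ) / 2)) ^ 2 = (16 * Real.pi) ^ d := by
          rw [← Real.rpow_natCast _ 2, ← Real.rpow_mul (by positivity), ← Real.rpow_natCast _ d]
          norm_num
        rw [hBm, mul_pow, h16]

/-- The partial derivative `∂_j G_t(x)` of the heat kernel. -/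
noncomputable def heatKernelPartial (d : ℕ) (j : Fin d) (t : ℝ) (x : EuclideanSpace ℝ (Fin d)) :
    ℝ :=
  -(x j / (2 * t)) * heatKernel d t x

lemma heatKernel_nonneg (d : ℕ) {t : ℝ} (ht : 0 ≤ t) (x : EuclideanSpace ℝ (Fin d)) :
    0 ≤ heatKernel d t x := by
  unfold heatKernel; positivity

lemma continuous_heatKernel (d : ℕ) (t : ℝ) : Continuous (heatKernel d t) := by
  unfold heatKernel; fun_prop

lemma hasFDerivAt_heatKernel (d : ℕ) {t : ℝ} (ht : 0 < t) (x : EuclideanSpace ℝ (Fin d)) :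
    HasFDerivAt (heatKernel d t) ((-heatKernel d t x / (2 * t)) • innerSL ℝ x) x := by
  have h := ((((hasStrictFDerivAt_norm_sq x).hasFDerivAt.neg).mul_const
    ((4 * t)⁻¹)).exp).const_mul ((4 * Real.pi * t) ^ (-(d : ℝ) / 2))
  refine h.congr_fderiv ?_
  ext v
  simp only [heatKernel, _root_.smul_apply, _root_.neg_apply, Pi.neg_apply, nsmul_eq_mul,
    smul_eq_mul, innerSL_apply_apply, div_eq_mul_inv]
  push_cast
  field_simp
  ring

lemma exists_norm_mul_heatKernel_le (d : ℕ) {t : ℝ} (ht : 0 < t) :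
    ∃ C, ∀ x : EuclideanSpace ℝ (Fin d),
      ‖(-heatKernel d t x / (2 * t)) • innerSL ℝ x‖ ≤ C := by
  refine ⟨(4 * Real.pi * t) ^ (-(d : ℝ) / 2) / (2 * t) * (1 + 4 * t), fun x => ?_⟩
  have hG := heatKernel_nonneg d ht.le x
  have hexp : ‖x‖ * Real.exp (-‖x‖ ^ 2 / (4 * t)) ≤ 1 + 4 * t := by
    rw [neg_div, Real.exp_neg, ← div_eq_mul_inv, div_le_iff₀ (Real.exp_pos _)]
    have h1 := Real.add_one_le_exp (‖x‖ ^ 2 / (4 * t))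
    calc ‖x‖ ≤ (1 + 4 * t) * (‖x‖ ^ 2 / (4 * t) + 1) := by
          have : (1 + 4 * t) * (‖x‖ ^ 2 / (4 * t) + 1) =
            ‖x‖ ^ 2 / (4 * t) + ‖x‖ ^ 2 + 1 + 4 * t := by field_simp; ring
          rw [this]
          have : 0 ≤ ‖x‖ ^ 2 / (4 * t) := by positivity
          nlinarith [sq_nonneg (‖x‖ - 1)]
      _ ≤ _ := by gcongr
  rw [norm_smul, innerSL_apply_norm, Real.norm_eq_abs, abs_div, abs_neg, abs_of_nonneg hG,
    abs_of_pos (by positivity : 0 < 2 * t)]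
  calc heatKernel d t x / (2 * t) * ‖x‖
      = (4 * Real.pi * t) ^ (-(d : ℝ) / 2) / (2 * t) *
          (‖x‖ * Real.exp (-‖x‖ ^ 2 / (4 * t))) := by unfold heatKernel; ring
    _ ≤ _ := by gcongr

/-- For continuous compactly supported `h`, the derivatives of `T_t h` fall on the heat kernel. -/
lemma fderiv_heatOp_apply_single (d : ℕ) {V : Type*} [NormedAddCommGroup V] [NormedSpace ℝ V]
    [CompleteSpace V] {t : ℝ} (ht : 0 < t) {h : EuclideanSpace ℝ (Fin d) → V} (hc : Continuous h)
    (hs : HasCompactSupport h) (x : EuclideanSpace ℝ (Fin d)) (j : Fin d) :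
    fderiv ℝ (heatOp d t h) x (EuclideanSpace.single j 1) =
      ∫ z, heatKernelPartial d j t (x - z) • h z := by
  have hop : heatOp d t h = fun x => ∫ z, heatKernel d t (x - z) • h z := by
    funext x
    rw [heatOp, ← integral_sub_left_eq_self (fun z => heatKernel d t (x - z) • h z) volume x]
    simp
  obtain ⟨C, hC⟩ := exists_norm_mul_heatKernel_le d ht
  set L : EuclideanSpace ℝ (Fin d) → EuclideanSpace ℝ (Fin d) →L[ℝ] ℝ :=
    fun x => (-heatKernel d t x / (2 * t)) • innerSL ℝ x with hL
  have hLc : Continuous L := by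
    have := continuous_heatKernel d t
    fun_prop
  have hhi : Integrable h := hc.integrable_of_hasCompactSupport hs
  have hF'c : Continuous fun z => (L (x - z)).smulRight (h z) := by
    have h1 : Continuous fun z => L (x - z) := by fun_prop
    exact (ContinuousLinearMap.smulRightL ℝ _ V).continuous₂.comp₂ h1 hc
  have hbd : ∀ z, ∀ y, ‖(L (y - z)).smulRight (h z)‖ ≤ C * ‖h z‖ := by
    intro z y
    rw [ContinuousLinearMap.norm_smulRight_apply]
    exact mul_le_mul_of_nonneg_right (hC _) (norm_nonneg _)
  have hd : HasFDerivAt (fun x => ∫ z, heatKernel d t (x - z) • h z)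
      (∫ z, (L (x - z)).smulRight (h z)) x := by
    refine hasFDerivAt_integral_of_dominated_of_fderiv_le (bound := fun z => C * ‖h z‖)
      (F' := fun x z => (L (x - z)).smulRight (h z)) Filter.univ_mem
      (Filter.Eventually.of_forall fun y => ?_) ?_ hF'c.aestronglyMeasurable
      (ae_of_all _ fun z y _ => hbd z y) (hhi.norm.const_mul C) (ae_of_all _ fun z y _ => ?_)
    · have := continuous_heatKernel d t
      exact Continuous.aestronglyMeasurable (by fun_prop)
    · have := continuous_heatKernel d t
      refine Continuous.integrable_of_hasCompactSupport (by fun_prop) ?_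
      exact hs.smul_left
    · have h1 : HasFDerivAt (fun y => heatKernel d t (y - z)) (L (y - z)) y := by
        have := (hasFDerivAt_heatKernel d ht (y - z)).comp y ((hasFDerivAt_id y).sub_const z)
        exact this
      exact h1.smul_const (h z)
  have hint : Integrable fun z => (L (x - z)).smulRight (h z) :=
    Integrable.mono' (hhi.norm.const_mul C) hF'c.aestronglyMeasurable
      (ae_of_all _ fun z => hbd z x)
  rw [hop, hd.fderiv, ContinuousLinearMap.integral_apply hint]
  refine integral_congr_ae (ae_of_all _ fun z => ?_)
  simp only [ContinuousLinearMap.smulRight_apply, hL, heatKernelPartial]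
  congr 1
  simp [EuclideanSpace.inner_single_right]
  ring

/-- Along a segment in space-time, the derivative of `∂_j G`. -/
lemma hasDerivAt_heatKernelPartial_segment (d : ℕ) (j : Fin d) (τ δ : ℝ)
    (z w : EuclideanSpace ℝ (Fin d)) (u : ℝ) (hu : 0 < τ + u * δ) :
    HasDerivAt (fun u => heatKernelPartial d j (τ + u * δ) (z + u • w))
      (-(1 / 2) * (w j / (τ + u * δ) - (z + u • w) j * δ / (τ + u * δ) ^ 2 +
        (z + u • w) j / (τ + u * δ) * (-(d * δ / (2 * (τ + u * δ))) -
          inner ℝ (z + u • w) w / (2 * (τ + u * δ)) +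
          ‖z + u • w‖ ^ 2 * δ / (4 * (τ + u * δ) ^ 2))) *
        heatKernel d (τ + u * δ) (z + u • w)) u := by
  have hθ : HasDerivAt (fun u : ℝ => τ + u * δ) δ u := by
    simpa using ((hasDerivAt_id u).mul_const δ).const_add τ
  have ha : HasDerivAt (fun u : ℝ => z + u • w) w u := by
    simpa using ((hasDerivAt_id u).smul_const w).const_add z
  have haj : HasDerivAt (fun u : ℝ => (z + u • w) j) (w j) u := by
    simpa using ((hasDerivAt_id u).mul_const (w j)).const_add (z j)
  have hn : HasDerivAt (fun u : ℝ => ‖z + u • w‖ ^ 2) (2 * inner ℝ (z + u • w) w) u := ha.norm_sq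
  set θ : ℝ := τ + u * δ with hθdef
  have hπ : 0 < 4 * Real.pi * θ := by positivity
  have hpow : HasDerivAt (fun u : ℝ => (4 * Real.pi * (τ + u * δ)) ^ (-(d : ℝ) / 2))
      (-(d * δ / (2 * θ)) * (4 * Real.pi * θ) ^ (-(d : ℝ) / 2)) u := by
    have := (hθ.const_mul (4 * Real.pi)).rpow_const (p := -(d : ℝ) / 2) (Or.inl hπ.ne')
    refine this.congr_deriv ?_
    rw [← hθdef, Real.rpow_sub_one hπ.ne']
    field_simp
  have hexp : HasDerivAt (fun u : ℝ => Real.exp (-‖z + u • w‖ ^ 2 / (4 * (τ + u * δ))))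
      (Real.exp (-‖z + u • w‖ ^ 2 / (4 * θ)) *
        (-(inner ℝ (z + u • w) w / (2 * θ)) + ‖z + u • w‖ ^ 2 * δ / (4 * θ ^ 2))) u := by
    have := ((hn.fun_neg.fun_div (hθ.const_mul 4) (by rw [← hθdef]; positivity))).exp
    refine this.congr_deriv ?_
    rw [← hθdef]
    field_simp
    ring
  have hq := haj.fun_div (hθ.const_mul 2) (by rw [← hθdef]; positivity)
  have := hq.fun_neg.fun_mul (hpow.fun_mul hexp)
  refine this.congr_deriv ?_
  simp only [← hθdef, heatKernel]
  field_simp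
  ring

/-- Polynomial factors and bounded shifts of the heat kernel are absorbed by a wider Gaussian. -/
lemma one_add_sq_mul_heatKernel_le (d : ℕ) {ρ θ : ℝ} (hρ : 8 ≤ ρ) (h1 : ρ / 2 ≤ θ) (h2 : θ ≤ ρ)
    (z a : EuclideanSpace ℝ (Fin d)) (hza : ‖z - a‖ ^ 2 ≤ 4 * d) :
    (1 + ‖a‖ ^ 2 / θ) ^ 2 * heatKernel d θ a ≤
      (256 * (2 : ℝ) ^ ((d : ℝ) / 2) * Real.exp d) *
        (ρ ^ (-(d : ℝ) / 2) * Real.exp (-‖z‖ ^ 2 / (16 * ρ))) := by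
  have hρ0 : 0 < ρ := by linarith
  have hθ0 : 0 < θ := by linarith
  set v : ℝ := ‖a‖ ^ 2 / θ with hv
  have hv0 : 0 ≤ v := by positivity
  have hpoly : (1 + v) ^ 2 ≤ 256 * Real.exp (v / 8) := by
    have he := Real.add_one_le_exp (v / 16)
    have h16 : Real.exp (v / 8) = Real.exp (v / 16) ^ 2 := by
      rw [← Real.exp_nat_mul]; congr 1; push_cast; ring
    rw [h16]
    have : 1 + v ≤ 16 * Real.exp (v / 16) := by linarith
    calc (1 + v) ^ 2 ≤ (16 * Real.exp (v / 16)) ^ 2 := by gcongr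
      _ = _ := by ring
  have hpw : (4 * Real.pi * θ) ^ (-(d : ℝ) / 2) ≤ (2 : ℝ) ^ ((d : ℝ) / 2) * ρ ^ (-(d : ℝ) / 2) := by
    have hle : ρ / 2 ≤ 4 * Real.pi * θ := by nlinarith [Real.pi_gt_three]
    calc (4 * Real.pi * θ) ^ (-(d : ℝ) / 2) ≤ (ρ / 2) ^ (-(d : ℝ) / 2) :=
          Real.rpow_le_rpow_of_nonpos (by positivity) hle
            (by rw [neg_div]; exact neg_nonpos.2 (by positivity))
      _ = _ := by
          rw [Real.div_rpow hρ0.le (by norm_num), div_eq_mul_inv, ← Real.rpow_neg (by norm_num)]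
          rw [mul_comm]; congr 2; ring
  have hzn : ‖z‖ ^ 2 ≤ 2 * ‖a‖ ^ 2 + 8 * d := by
    have : ‖z‖ ≤ ‖a‖ + ‖z - a‖ := by
      calc ‖z‖ = ‖a + (z - a)‖ := by congr 1; abel
        _ ≤ _ := norm_add_le _ _
    nlinarith [norm_nonneg z, sq_nonneg (‖a‖ - ‖z - a‖), norm_nonneg a, norm_nonneg (z - a)]
  have hexp : Real.exp (-v / 8) ≤ Real.exp d * Real.exp (-‖z‖ ^ 2 / (16 * ρ)) := by
    rw [← Real.exp_add]
    refine Real.exp_le_exp.2 ?_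
    have hva : ‖a‖ ^ 2 / ρ ≤ v := by rw [hv]; gcongr
    have : ‖z‖ ^ 2 / (16 * ρ) ≤ ‖a‖ ^ 2 / ρ / 8 + d := by
      rw [div_le_iff₀ (by positivity)]
      have : (‖a‖ ^ 2 / ρ / 8 + d) * (16 * ρ) = 2 * ‖a‖ ^ 2 + 16 * ρ * d := by field_simp; ring
      rw [this]
      have hd : (0 : ℝ) ≤ d := Nat.cast_nonneg d
      nlinarith
    rw [neg_div, neg_div]
    linarith
  have hker : heatKernel d θ a = (4 * Real.pi * θ) ^ (-(d : ℝ) / 2) *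
      (Real.exp (-v / 8) * Real.exp (-v / 8)) := by
    rw [heatKernel, ← Real.exp_add, hv]
    congr 2; field_simp; ring
  have hcancel : Real.exp (v / 8) * Real.exp (-v / 8) = 1 := by
    rw [← Real.exp_add]; simp [neg_div]
  calc (1 + v) ^ 2 * heatKernel d θ a
      ≤ (256 * Real.exp (v / 8)) * heatKernel d θ a := by
        gcongr; exact heatKernel_nonneg d hθ0.le a
    _ = 256 * (4 * Real.pi * θ) ^ (-(d : ℝ) / 2) * Real.exp (-v / 8) := by
        rw [hker]; linear_combination
          (256 * (4 * Real.pi * θ) ^ (-(d : ℝ) / 2) * Real.exp (-v / 8)) * hcancel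
    _ ≤ 256 * ((2 : ℝ) ^ ((d : ℝ) / 2) * ρ ^ (-(d : ℝ) / 2)) *
          (Real.exp d * Real.exp (-‖z‖ ^ 2 / (16 * ρ))) := by gcongr
    _ = _ := by ring

lemma norm_coord_le {d : ℕ} (a : EuclideanSpace ℝ (Fin d)) (j : Fin d) : |a j| ≤ ‖a‖ :=
  PiLp.norm_apply_le a j

/-- Size estimate for `∂_j G`. -/
lemma abs_heatKernelPartial_le (d : ℕ) (j : Fin d) {ρ θ : ℝ} (hρ : 8 ≤ ρ) (h1 : ρ / 2 ≤ θ)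
    (h2 : θ ≤ ρ) (z : EuclideanSpace ℝ (Fin d)) :
    |heatKernelPartial d j θ z| ≤
      (256 * (2 : ℝ) ^ ((d : ℝ) / 2) * Real.exp d) *
        (ρ ^ (-(d : ℝ) / 2) * Real.exp (-‖z‖ ^ 2 / (16 * ρ))) := by
  have hθ : 4 ≤ θ := by linarith
  have hθ0 : 0 < θ := by linarith
  refine le_trans ?_ (one_add_sq_mul_heatKernel_le d hρ h1 h2 z z (by simp))
  have hG := heatKernel_nonneg d hθ0.le z
  rw [heatKernelPartial, abs_mul, abs_of_nonneg hG, abs_neg, abs_div,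
    abs_of_pos (by positivity : 0 < 2 * θ)]
  refine mul_le_mul_of_nonneg_right ?_ hG
  have hj := norm_coord_le z j
  have hz : ‖z‖ / (2 * θ) ≤ 1 + ‖z‖ ^ 2 / θ := by
    rw [div_le_iff₀ (by positivity)]
    have : (1 + ‖z‖ ^ 2 / θ) * (2 * θ) = 2 * θ + 2 * ‖z‖ ^ 2 := by field_simp
    rw [this]; nlinarith [sq_nonneg (‖z‖ - 1)]
  have hv : 0 ≤ ‖z‖ ^ 2 / θ := by positivity
  calc |z j| / (2 * θ) ≤ ‖z‖ / (2 * θ) := by gcongr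
    _ ≤ 1 + ‖z‖ ^ 2 / θ := hz
    _ ≤ (1 + ‖z‖ ^ 2 / θ) ^ 2 := by nlinarith

/-- Under bounded displacements in space-time, `∂_j G` changes by an extra factor `ρ⁻¹`. -/
lemma abs_heatKernelPartial_sub_le (d : ℕ) (j : Fin d) {ρ τ σ : ℝ} (hρ : 8 ≤ ρ)
    (hτ1 : ρ / 2 ≤ τ) (hτ2 : τ ≤ ρ) (hσ1 : ρ / 2 ≤ σ) (hσ2 : σ ≤ ρ) (hτσ : |σ - τ| ≤ 4)
    (z y : EuclideanSpace ℝ (Fin d)) (hzy : ‖y - z‖ ^ 2 ≤ 4 * d) :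
    |heatKernelPartial d j σ y - heatKernelPartial d j τ z| ≤
      (2 * (10 * d + 10) * (256 * (2 : ℝ) ^ ((d : ℝ) / 2) * Real.exp d) / ρ) *
        (ρ ^ (-(d : ℝ) / 2) * Real.exp (-‖z‖ ^ 2 / (16 * ρ))) := by
  set δ := σ - τ with hδ
  set w := y - z with hw
  have hρ0 : 0 < ρ := by linarith
  have hθ : ∀ u ∈ Set.Icc (0 : ℝ) 1, ρ / 2 ≤ τ + u * δ ∧ τ + u * δ ≤ ρ := by
    rintro u ⟨hu0, hu1⟩
    constructor <;> nlinarith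
  have hmv := norm_image_sub_le_of_norm_deriv_le_segment_01'
    (f := fun u : ℝ => heatKernelPartial d j (τ + u * δ) (z + u • w))
    (C := (2 * (10 * d + 10) * (256 * (2 : ℝ) ^ ((d : ℝ) / 2) * Real.exp d) / ρ) *
        (ρ ^ (-(d : ℝ) / 2) * Real.exp (-‖z‖ ^ 2 / (16 * ρ))))
    (fun u hu => (hasDerivAt_heatKernelPartial_segment d j τ δ z w u
      (by linarith [(hθ u hu).1])).hasDerivWithinAt) ?_
  · simpa [hδ, hw] using hmv
  intro u hu
  obtain ⟨ht1, ht2⟩ := hθ u (Set.Ico_subset_Icc_self hu)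
  set θ := τ + u * δ
  set a := z + u • w with ha
  have hθ4 : 4 ≤ θ := by linarith
  have hθ0 : 0 < θ := by linarith
  have hd : (0 : ℝ) ≤ d := Nat.cast_nonneg d
  have hza : ‖z - a‖ ^ 2 ≤ 4 * d := by
    have : z - a = -(u • w) := by rw [ha]; abel
    rw [this, norm_neg, norm_smul, mul_pow, Real.norm_eq_abs, sq_abs]
    have : u ^ 2 ≤ 1 := by nlinarith [hu.1, hu.2]
    nlinarith [sq_nonneg ‖w‖]
  have hwn : ‖w‖ ≤ 1 + 4 * d := by nlinarith [sq_nonneg (‖w‖ - 1)]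
  have hG := heatKernel_nonneg d hθ0.le a
  set v : ℝ := ‖a‖ ^ 2 / θ with hv
  have hv0 : 0 ≤ v := by positivity
  have haθ : ‖a‖ / θ ≤ 1 + v := by
    rw [div_le_iff₀ hθ0]
    have : (1 + v) * θ = θ + ‖a‖ ^ 2 := by rw [hv]; field_simp
    rw [this]; nlinarith [sq_nonneg (‖a‖ - 1)]
  have haj : |a j| / θ ≤ ‖a‖ / θ := by gcongr; exact norm_coord_le a j
  have hin : |inner ℝ a w| ≤ ‖a‖ * ‖w‖ := abs_real_inner_le_norm a w
  have hbr : |-(d * δ / (2 * θ)) - inner ℝ a w / (2 * θ) + ‖a‖ ^ 2 * δ / (4 * θ ^ 2)| ≤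
      (2 * d + ‖a‖ * ‖w‖ / 2 + v) / θ := by
    have e1 : |d * δ / (2 * θ)| ≤ 2 * d / θ := by
      rw [abs_div, abs_mul, abs_of_nonneg hd, abs_of_pos (by positivity : 0 < 2 * θ),
        div_le_div_iff₀ (by positivity) hθ0]
      have : d * |δ| ≤ d * 4 := by gcongr
      nlinarith
    have e2 : |inner ℝ a w / (2 * θ)| ≤ ‖a‖ * ‖w‖ / 2 / θ := by
      rw [abs_div, abs_of_pos (by positivity : 0 < 2 * θ), div_div]
      gcongr
    have e3 : |‖a‖ ^ 2 * δ / (4 * θ ^ 2)| ≤ v / θ := by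
      rw [abs_div, abs_mul, abs_of_nonneg (sq_nonneg ‖a‖),
        abs_of_pos (by positivity : 0 < 4 * θ ^ 2), hv]
      calc ‖a‖ ^ 2 * |δ| / (4 * θ ^ 2) ≤ ‖a‖ ^ 2 * 4 / (4 * θ ^ 2) := by gcongr
        _ = _ := by field_simp
    calc _ ≤ |d * δ / (2 * θ)| + |inner ℝ a w / (2 * θ)| + |‖a‖ ^ 2 * δ / (4 * θ ^ 2)| := by
          refine (abs_add_le _ _).trans (add_le_add_left ((abs_sub _ _).trans ?_) _)
          rw [abs_neg]
      _ ≤ 2 * d / θ + ‖a‖ * ‖w‖ / 2 / θ + v / θ := by gcongr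
      _ = _ := by ring
  have hcoef : |w j / θ - a j * δ / θ ^ 2 +
        a j / θ * (-(d * δ / (2 * θ)) - inner ℝ a w / (2 * θ) + ‖a‖ ^ 2 * δ / (4 * θ ^ 2))| ≤
      2 * (10 * d + 10) / ρ * (1 + v) ^ 2 := by
    have e1 : |w j / θ| ≤ (1 + 4 * d) / θ := by
      rw [abs_div, abs_of_pos hθ0]
      gcongr; exact (norm_coord_le w j).trans hwn
    have e2 : |a j * δ / θ ^ 2| ≤ (1 + v) * 4 / θ := by
      rw [abs_div, abs_mul, abs_of_pos (by positivity : 0 < θ ^ 2)]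
      calc |a j| * |δ| / θ ^ 2 = (|a j| / θ) * |δ| / θ := by field_simp
        _ ≤ _ := by gcongr; exact haj.trans haθ
    have e3 : ‖a‖ / θ * ((2 * d + ‖a‖ * ‖w‖ / 2 + v) / θ) ≤
        ((1 + v) * (2 * d) + v * ((1 + 4 * d) / 2) + (1 + v) * v) / θ := by
      calc ‖a‖ / θ * ((2 * d + ‖a‖ * ‖w‖ / 2 + v) / θ)
          = (‖a‖ / θ * (2 * d) + v * (‖w‖ / 2) + ‖a‖ / θ * v) / θ := by
            rw [hv]; field_simp
        _ ≤ _ := by gcongr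
    have e4 : |a j / θ * (-(d * δ / (2 * θ)) - inner ℝ a w / (2 * θ) +
        ‖a‖ ^ 2 * δ / (4 * θ ^ 2))| ≤ ‖a‖ / θ * ((2 * d + ‖a‖ * ‖w‖ / 2 + v) / θ) := by
      rw [abs_mul, abs_div (a j), abs_of_pos hθ0]
      gcongr
    have hpoly : 1 + 4 * d + (1 + v) * 4 +
        ((1 + v) * (2 * d) + v * ((1 + 4 * d) / 2) + (1 + v) * v) ≤
          (10 * d + 10) * (1 + v) ^ 2 := by
      nlinarith [mul_nonneg hd hv0, mul_nonneg hd (sq_nonneg v), sq_nonneg v]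
    calc _ ≤ |w j / θ| + |a j * δ / θ ^ 2| + |a j / θ * (-(d * δ / (2 * θ)) -
            inner ℝ a w / (2 * θ) + ‖a‖ ^ 2 * δ / (4 * θ ^ 2))| :=
          (abs_add_le _ _).trans (add_le_add_left (abs_sub _ _) _)
      _ ≤ (1 + 4 * d) / θ + (1 + v) * 4 / θ +
          ((1 + v) * (2 * d) + v * ((1 + 4 * d) / 2) + (1 + v) * v) / θ := by
          gcongr; exact e4.trans e3
      _ = (1 + 4 * d + (1 + v) * 4 +
          ((1 + v) * (2 * d) + v * ((1 + 4 * d) / 2) + (1 + v) * v)) / θ := by ring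
      _ ≤ (10 * d + 10) * (1 + v) ^ 2 / (ρ / 2) := by gcongr
      _ = _ := by field_simp
  rw [Real.norm_eq_abs, abs_mul, abs_mul, abs_of_nonneg hG]
  have hhalf : |(-(1 / 2) : ℝ)| ≤ 1 := by norm_num [abs_le]
  calc _ ≤ 1 * (2 * (10 * d + 10) / ρ * (1 + v) ^ 2) * heatKernel d θ a := by gcongr
    _ = 2 * (10 * d + 10) / ρ * ((1 + v) ^ 2 * heatKernel d θ a) := by ring
    _ ≤ 2 * (10 * d + 10) / ρ * ((256 * (2 : ℝ) ^ ((d : ℝ) / 2) * Real.exp d) *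
        (ρ ^ (-(d : ℝ) / 2) * Real.exp (-‖z‖ ^ 2 / (16 * ρ)))) := by
        refine mul_le_mul_of_nonneg_left ?_ (by positivity)
        exact one_add_sq_mul_heatKernel_le d hρ ht1 ht2 z a hza
    _ = _ := by ring

/-- The mixed `L²(ν; L^{1/H}(μ))` norm. -/
noncomputable def mixedNorm (H : ℝ) (μ ν : Measure ℝ) (a : ℝ → ℝ → ℝ≥0∞) : ℝ≥0∞ :=
  (∫⁻ r, (∫⁻ θ, a r θ ^ (1 / H) ∂μ) ^ (2 * H) ∂ν) ^ (1 / 2 : ℝ)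

lemma mixedNorm_mono {H : ℝ} (hH : 0 < H) {μ ν : Measure ℝ} {a b : ℝ → ℝ → ℝ≥0∞}
    (hab : ∀ r θ, a r θ ≤ b r θ) : mixedNorm H μ ν a ≤ mixedNorm H μ ν b := by
  unfold mixedNorm
  gcongr
  exact hab _ _

/-- Minkowski's inequality for the mixed norm. -/
lemma mixedNorm_add_le {H : ℝ} (hH : 0 < H) (hH1 : H ≤ 1) {μ ν : Measure ℝ} [SFinite μ]
    {a b : ℝ → ℝ → ℝ≥0∞} (ha : Measurable (Function.uncurry a))
    (hb : Measurable (Function.uncurry b)) :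
    mixedNorm H μ ν (fun r θ => a r θ + b r θ) ≤ mixedNorm H μ ν a + mixedNorm H μ ν b := by
  have key : ∀ c : ℝ → ℝ → ℝ≥0∞, mixedNorm H μ ν c =
      (∫⁻ r, ((∫⁻ θ, c r θ ^ (1 / H) ∂μ) ^ (1 / (1 / H))) ^ (2 : ℝ) ∂ν) ^ (1 / (2 : ℝ)) := by
    intro c
    simp only [mixedNorm, ← ENNReal.rpow_mul, one_div_one_div, mul_comm H 2]
  have hm : ∀ c : ℝ → ℝ → ℝ≥0∞, Measurable (Function.uncurry c) →
      Measurable fun r => (∫⁻ θ, c r θ ^ (1 / H) ∂μ) ^ (1 / (1 / H)) := fun c hc =>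
    (Measurable.lintegral_prod_right' (f := fun q : ℝ × ℝ => c q.1 q.2 ^ (1 / H))
      (hc.pow_const _)).pow_const _
  rw [key, key, key]
  refine le_trans ?_ (ENNReal.lintegral_Lp_add_le (hm a ha).aemeasurable (hm b hb).aemeasurable
    one_le_two)
  gcongr with r
  refine ENNReal.lintegral_Lp_add_le (f := a r) (g := b r) ?_ ?_ ?_
  · exact (ha.comp measurable_prodMk_left).aemeasurable
  · exact (hb.comp measurable_prodMk_left).aemeasurable
  · rw [le_div_iff₀ hH]; linarith

/-- Pointwise bounds of squares by a weight pass to the mixed norm. -/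
lemma mixedNorm_sq_le {H : ℝ} (hH : 0 < H) {μ : Measure ℝ} {I : Set ℝ} (hI : MeasurableSet I)
    {a m : ℝ → ℝ → ℝ≥0∞} {K : ℝ → ℝ≥0∞} (hK : ∀ r, K r ≠ ∞)
    (h : ∀ r ∈ I, ∀ θ, a r θ ^ 2 ≤ K r * m r θ) :
    mixedNorm H μ (volume.restrict I) a ^ 2 ≤
      ∫⁻ r in I, K r * (∫⁻ θ, m r θ ^ (1 / (2 * H)) ∂μ) ^ (2 * H) := by
  have h2 : mixedNorm H μ (volume.restrict I) a ^ 2 =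
      ∫⁻ r in I, (∫⁻ θ, a r θ ^ (1 / H) ∂μ) ^ (2 * H) := by
    rw [mixedNorm, ← ENNReal.rpow_two, ← ENNReal.rpow_mul]; norm_num
  rw [h2]
  refine setLIntegral_mono' hI fun r hr => ?_
  have hin : ∫⁻ θ, a r θ ^ (1 / H) ∂μ ≤
      K r ^ (1 / (2 * H)) * ∫⁻ θ, m r θ ^ (1 / (2 * H)) ∂μ := by
    rw [← lintegral_const_mul' _ _ (ENNReal.rpow_ne_top_of_nonneg (by positivity) (hK r))]
    refine lintegral_mono fun θ => ?_
    rw [← ENNReal.mul_rpow_of_nonneg _ _ (by positivity)]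
    calc a r θ ^ (1 / H) = (a r θ ^ 2) ^ (1 / (2 * H)) := by
          rw [← ENNReal.rpow_two, ← ENNReal.rpow_mul]; congr 1; field_simp
      _ ≤ _ := ENNReal.rpow_le_rpow (h r hr θ) (by positivity)
  calc (∫⁻ θ, a r θ ^ (1 / H) ∂μ) ^ (2 * H)
      ≤ (K r ^ (1 / (2 * H)) * ∫⁻ θ, m r θ ^ (1 / (2 * H)) ∂μ) ^ (2 * H) := by gcongr
    _ = _ := by
        rw [ENNReal.mul_rpow_of_nonneg _ _ (by positivity), ← ENNReal.rpow_mul,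
          one_div_mul_cancel (by positivity), ENNReal.rpow_one]

/-- The iterated Bochner integral is the mixed norm when the latter is finite. -/
lemma rpow_integral_eq_toReal_mixedNorm {H : ℝ} (hH : 0 < H) {μ ν : Measure ℝ} [SFinite μ]
    {A : ℝ → ℝ → ℝ} (hA : Measurable (Function.uncurry A)) (hA0 : ∀ r θ, 0 ≤ A r θ)
    (hfin : mixedNorm H μ ν (fun r θ => ENNReal.ofReal (A r θ)) ≠ ∞) :
    (∫ r, (∫ θ, (A r θ ^ 2) ^ (1 / (2 * H)) ∂μ) ^ (2 * H) ∂ν) ^ ((1 : ℝ) / 2) =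
      (mixedNorm H μ ν (fun r θ => ENNReal.ofReal (A r θ))).toReal := by
  set J : ℝ → ℝ≥0∞ := fun r => ∫⁻ θ, ENNReal.ofReal (A r θ) ^ (1 / H) ∂μ with hJ
  have hJm : Measurable J :=
    Measurable.lintegral_prod_right' (f := fun q : ℝ × ℝ => ENNReal.ofReal (A q.1 q.2) ^ (1 / H))
      (hA.ennreal_ofReal.pow_const _)
  have hin : ∀ r, ∫ θ, (A r θ ^ 2) ^ (1 / (2 * H)) ∂μ = (J r).toReal := by
    intro r
    have hAr : Measurable (A r) := hA.comp measurable_prodMk_left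
    rw [integral_eq_lintegral_of_nonneg_ae (ae_of_all _ fun θ => by positivity)
      (((hAr.pow_const 2).pow_const _).aestronglyMeasurable)]
    congr 1
    refine lintegral_congr fun θ => ?_
    rw [ENNReal.ofReal_rpow_of_nonneg (hA0 r θ) (by positivity), ← Real.rpow_two,
      ← Real.rpow_mul (hA0 r θ)]
    congr 2; field_simp
  have hfin' : ∫⁻ r, J r ^ (2 * H) ∂ν ≠ ∞ := by
    intro hc
    apply hfin
    rw [mixedNorm, hc]; simp
  simp only [hin]
  rw [integral_eq_lintegral_of_nonneg_ae (ae_of_all _ fun r => by positivity)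
      ((hJm.ennreal_toReal.pow_const _).aestronglyMeasurable), mixedNorm, ENNReal.toReal_rpow]
  congr 2
  refine lintegral_congr_ae ?_
  filter_upwards [ae_lt_top (hJm.pow_const (2 * H)) hfin'] with r hr
  have hJr : J r ≠ ∞ := by
    intro hc
    rw [hc, ENNReal.top_rpow_of_pos (by positivity)] at hr
    exact lt_irrefl _ hr
  rw [← ENNReal.ofReal_rpow_of_nonneg ENNReal.toReal_nonneg (by positivity),
    ENNReal.ofReal_toReal hJr]

/-- A dyadic decomposition: quadratically decaying averages over the past are bounded by the
maximal function. -/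
lemma lintegral_div_sq_mul_le_maxT (F : ℝ → ℝ≥0∞) {t c : ℝ} (hc : 0 ≤ c)
    (ht : t ∈ Set.Icc (-4 : ℝ) 0) :
    ∫⁻ r in Set.Iio (-8 : ℝ), ENNReal.ofReal (c / r ^ 2) * F r ≤
      ENNReal.ofReal (2 * c) * maxT F t := by
  set S : ℕ → Set ℝ := fun k => Set.Ioc (-(16 * 2 ^ k)) (-(8 * 2 ^ k)) with hS
  have hcover : Set.Iio (-8 : ℝ) ⊆ ⋃ k, S k := by
    intro r (hr : r < -8)
    obtain ⟨k, hk1, hk2⟩ := exists_nat_pow_near (x := -r / 8) (y := (2 : ℝ)) (by linarith)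
      one_lt_two
    refine Set.mem_iUnion.2 ⟨k, ?_, ?_⟩ <;> rw [pow_succ] at hk2 <;> linarith
  have hpiece : ∀ k, ∫⁻ r in S k, ENNReal.ofReal (c / r ^ 2) * F r ≤
      ENNReal.ofReal (c * (1 / 2) ^ k) * maxT F t := by
    intro k
    have h2k : (1 : ℝ) ≤ 2 ^ k := one_le_pow₀ one_le_two
    calc ∫⁻ r in S k, ENNReal.ofReal (c / r ^ 2) * F r
        ≤ ∫⁻ r in S k, ENNReal.ofReal (c / (8 * 2 ^ k) ^ 2) * F r := by
          refine setLIntegral_mono' measurableSet_Ioc fun r hr => ?_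
          have : (8 * 2 ^ k) ^ 2 ≤ r ^ 2 := by nlinarith [hr.1, hr.2]
          gcongr
      _ = ENNReal.ofReal (c / (8 * 2 ^ k) ^ 2) * ∫⁻ r in S k, F r :=
          lintegral_const_mul' _ _ ENNReal.ofReal_ne_top
      _ ≤ ENNReal.ofReal (c / (8 * 2 ^ k) ^ 2) * (ENNReal.ofReal (2 * (32 * 2 ^ k)) * maxT F t) := by
          gcongr
          refine le_trans (lintegral_mono_set fun r hr => ?_)
            (lintegral_Ioo_le_mul_maxT F t (by positivity))
          obtain ⟨ht1, ht2⟩ := ht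
          constructor <;> linarith [hr.1, hr.2]
      _ = _ := by
          rw [← mul_assoc, ← ENNReal.ofReal_mul (by positivity)]
          congr 2
          rw [one_div, inv_pow]
          field_simp
          ring
  calc ∫⁻ r in Set.Iio (-8 : ℝ), ENNReal.ofReal (c / r ^ 2) * F r
      ≤ ∫⁻ r in ⋃ k, S k, ENNReal.ofReal (c / r ^ 2) * F r := lintegral_mono_set hcover
    _ ≤ ∑' k, ∫⁻ r in S k, ENNReal.ofReal (c / r ^ 2) * F r := lintegral_iUnion_le _ _
    _ ≤ ∑' k : ℕ, ENNReal.ofReal (c * (1 / 2) ^ k) * maxT F t := ENNReal.tsum_le_tsum hpiece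
    _ = ENNReal.ofReal (2 * c) * maxT F t := by
        rw [ENNReal.tsum_mul_right, ← ENNReal.ofReal_tsum_of_nonneg (fun k => by positivity)
          (summable_geometric_two.mul_left c), tsum_mul_left, tsum_geometric_two, mul_comm c]

/-- The gradient of `T_t h` at `x`, written with the derivatives on the heat kernel. -/
noncomputable def heatGrad (d : ℕ) {V : Type*} [NormedAddCommGroup V] [NormedSpace ℝ V] (t : ℝ)
    (h : EuclideanSpace ℝ (Fin d) → V) (x : EuclideanSpace ℝ (Fin d)) :
    PiLp 2 (fun _ : Fin d => V) :=
  WithLp.toLp 2 fun j => ∫ z, heatKernelPartial d j t (x - z) • h z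

lemma enorm_piLp_sq_le {d : ℕ} {V : Type*} [NormedAddCommGroup V]
    {v : PiLp 2 (fun _ : Fin d => V)} {C : ℝ≥0∞} (hv : ∀ j, ‖v j‖ₑ ^ 2 ≤ C) : ‖v‖ₑ ^ 2 ≤ d * C := by
  have : ‖v‖ₑ ^ 2 = ∑ j, ‖v j‖ₑ ^ 2 := by
    rw [← ofReal_norm, ← ENNReal.ofReal_pow (norm_nonneg _), PiLp.norm_sq_eq_of_L2,
      ENNReal.ofReal_sum_of_nonneg fun _ _ => by positivity]
    refine Finset.sum_congr rfl fun j _ => ?_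
    rw [ENNReal.ofReal_pow (norm_nonneg _), ofReal_norm]
  rw [this]
  refine (Finset.sum_le_card_nsmul _ _ C fun j _ => hv j).trans (le_of_eq ?_)
  simp

section

variable {d : ℕ} {V : Type*} [NormedAddCommGroup V] [NormedSpace ℝ V]

lemma gradHeatNormSq_eq_norm_heatGrad_sq [CompleteSpace V] {t : ℝ} (ht : 0 < t)
    {h : EuclideanSpace ℝ (Fin d) → V}
    (hc : Continuous h) (hs : HasCompactSupport h) (x : EuclideanSpace ℝ (Fin d)) :
    gradHeatNormSq d t h x = ‖heatGrad d t h x‖ ^ 2 := by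
  rw [PiLp.norm_sq_eq_of_L2, gradHeatNormSq]
  refine Finset.sum_congr rfl fun j _ => ?_
  rw [fderiv_heatOp_apply_single d ht hc hs]
  rfl

lemma heatGrad_zero (t : ℝ) (x : EuclideanSpace ℝ (Fin d)) :
    heatGrad d t (fun _ => (0 : V)) x = 0 := by
  ext j; simp [heatGrad]

/-- Size of the gradient in terms of the maximal function. -/
lemma enorm_heatGrad_sq_le {h : EuclideanSpace ℝ (Fin d) → V} (hc : Continuous h)
    (x : EuclideanSpace ℝ (Fin d)) {ρ θ : ℝ} (hρ : 8 ≤ ρ) (h1 : ρ / 2 ≤ θ) (h2 : θ ≤ ρ) :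
    ‖heatGrad d θ h x‖ₑ ^ 2 ≤
      ENNReal.ofReal (d * ((256 * (2 : ℝ) ^ ((d : ℝ) / 2) * Real.exp d) ^ 2 *
        (16 * Real.pi) ^ d)) * maxX d (fun z => ‖h z‖ ^ 2) x := by
  rw [ENNReal.ofReal_mul (Nat.cast_nonneg d), ENNReal.ofReal_natCast, mul_assoc]
  refine enorm_piLp_sq_le fun j => ?_
  exact enorm_integral_smul_sq_le_maxX d hc x (by positivity) (by linarith)
    fun z => abs_heatKernelPartial_le d j hρ h1 h2 (x - z)

lemma integrable_heatKernelPartial_smul {h : EuclideanSpace ℝ (Fin d) → V} (hc : Continuous h)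
    (hs : HasCompactSupport h) (j : Fin d) (t : ℝ) (x : EuclideanSpace ℝ (Fin d)) :
    Integrable fun z => heatKernelPartial d j t (x - z) • h z := by
  have : Continuous (heatKernelPartial d j t) := by
    have := continuous_heatKernel d t
    unfold heatKernelPartial
    fun_prop
  refine Continuous.integrable_of_hasCompactSupport (by fun_prop) ?_
  exact hs.smul_left

/-- The gradient oscillation gains a factor `ρ⁻¹`. -/
lemma enorm_heatGrad_sub_sq_le {h : EuclideanSpace ℝ (Fin d) → V} (hc : Continuous h)
    (hs : HasCompactSupport h) {x y : EuclideanSpace ℝ (Fin d)} (hxy : ‖y - x‖ ^ 2 ≤ 4 * d)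
    {ρ τ σ : ℝ} (hρ : 8 ≤ ρ) (hτ1 : ρ / 2 ≤ τ) (hτ2 : τ ≤ ρ) (hσ1 : ρ / 2 ≤ σ) (hσ2 : σ ≤ ρ)
    (hτσ : |σ - τ| ≤ 4) :
    ‖heatGrad d σ h y - heatGrad d τ h x‖ₑ ^ 2 ≤
      ENNReal.ofReal (d * ((2 * (10 * d + 10) * (256 * (2 : ℝ) ^ ((d : ℝ) / 2) * Real.exp d)) ^ 2 *
        (16 * Real.pi) ^ d) / ρ ^ 2) * maxX d (fun z => ‖h z‖ ^ 2) x := by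
  rw [mul_div_assoc, ENNReal.ofReal_mul (Nat.cast_nonneg d), ENNReal.ofReal_natCast, mul_assoc]
  refine enorm_piLp_sq_le fun j => ?_
  have hsub : (heatGrad d σ h y - heatGrad d τ h x) j =
      ∫ z, (heatKernelPartial d j σ (y - z) - heatKernelPartial d j τ (x - z)) • h z := by
    simp only [sub_smul]
    rw [integral_sub (integrable_heatKernelPartial_smul hc hs j σ y)
      (integrable_heatKernelPartial_smul hc hs j τ x)]
    rfl
  rw [hsub]
  refine (enorm_integral_smul_sq_le_maxX d hc x
    (A := 2 * (10 * d + 10) * (256 * (2 : ℝ) ^ ((d : ℝ) / 2) * Real.exp d) / ρ) (ρ := ρ)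
    (by positivity) (by linarith) fun z => abs_heatKernelPartial_sub_le d j hρ hτ1 hτ2 hσ1 hσ2 hτσ
      (x - z) (y - z) (by rwa [sub_sub_sub_cancel_right])).trans (le_of_eq ?_)
  rw [div_pow, div_mul_eq_mul_div]

/-- Joint measurability in the time and mark variables of the gradient norm. -/
lemma measurable_norm_heatGrad {f : ℝ → EuclideanSpace ℝ (Fin d) → ℝ → V}
    (hf : StronglyMeasurable fun q : ℝ × EuclideanSpace ℝ (Fin d) × ℝ => f q.1 q.2.1 q.2.2)
    (t : ℝ) (x : EuclideanSpace ℝ (Fin d)) :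
    Measurable fun q : ℝ × ℝ => ‖heatGrad d (t - q.1) (fun y => f q.1 y q.2) x‖ := by
  have hj : ∀ j : Fin d, Measurable fun q : ℝ × ℝ =>
      ‖(heatGrad d (t - q.1) (fun y => f q.1 y q.2) x) j‖ := by
    intro j
    have hk : Measurable fun q : (ℝ × ℝ) × EuclideanSpace ℝ (Fin d) =>
        heatKernelPartial d j (t - q.1.1) (x - q.2) := by
      unfold heatKernelPartial heatKernel
      fun_prop
    have hfc : StronglyMeasurable fun q : (ℝ × ℝ) × EuclideanSpace ℝ (Fin d) =>
        f q.1.1 q.2 q.1.2 :=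
      hf.comp_measurable (g := fun q : (ℝ × ℝ) × EuclideanSpace ℝ (Fin d) =>
        (q.1.1, q.2, q.1.2)) (by fun_prop)
    exact (StronglyMeasurable.integral_prod_right' (hk.stronglyMeasurable.smul hfc)).norm.measurable
  have : (fun q : ℝ × ℝ => ‖heatGrad d (t - q.1) (fun y => f q.1 y q.2) x‖) =
      fun q : ℝ × ℝ => Real.sqrt
        (∑ j, ‖(heatGrad d (t - q.1) (fun y => f q.1 y q.2) x) j‖ ^ 2) := by
    funext q; exact PiLp.norm_eq_of_L2 _
  rw [this]
  exact (Finset.measurable_fun_sum _ fun j _ => (hj j).pow_const 2).sqrt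

end

/-- When the mixed norm of the gradient is finite, `𝒢f` equals it. -/
lemma calG_eq_toReal_mixedNorm {d : ℕ} {V : Type*} [NormedAddCommGroup V] [NormedSpace ℝ V]
    [CompleteSpace V] {H : ℝ} (hH : 0 < H) (α β : EReal)
    {f : ℝ → EuclideanSpace ℝ (Fin d) → ℝ → V}
    (hf : StronglyMeasurable fun q : ℝ × EuclideanSpace ℝ (Fin d) × ℝ => f q.1 q.2.1 q.2.2)
    (hc : ∀ r θ, Continuous fun y => f r y θ) (hs : ∀ r θ, HasCompactSupport fun y => f r y θ)
    (hz : ∀ r y θ, (-8 : ℝ) ≤ r → f r y θ = 0) {t : ℝ} (ht : -8 ≤ t)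
    (x : EuclideanSpace ℝ (Fin d))
    (hfin : mixedNorm H (volume.restrict {θ : ℝ | α < (θ : EReal) ∧ (θ : EReal) < β})
      (volume.restrict (Set.Iio (-8)))
      (fun r θ => ‖heatGrad d (t - r) (fun y => f r y θ) x‖ₑ) ≠ ∞) :
    calG d H α β f t x =
      (mixedNorm H (volume.restrict {θ : ℝ | α < (θ : EReal) ∧ (θ : EReal) < β})
        (volume.restrict (Set.Iio (-8)))
        (fun r θ => ‖heatGrad d (t - r) (fun y => f r y θ) x‖ₑ)).toReal := by
  simp only [← ofReal_norm] at hfin ⊢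
  rw [← rpow_integral_eq_toReal_mixedNorm hH
    (A := fun r θ => ‖heatGrad d (t - r) (fun y => f r y θ) x‖) (measurable_norm_heatGrad hf t x)
    (fun _ _ => norm_nonneg _) hfin, calG]
  congr 1
  have hgrad : ∀ r < t, ∀ θ, gradHeatNormSq d (t - r) (fun y => f r y θ) x =
      ‖heatGrad d (t - r) (fun y => f r y θ) x‖ ^ 2 := fun r hr θ =>
    gradHeatNormSq_eq_norm_heatGrad_sq (sub_pos.2 hr) (hc r θ) (hs r θ) x
  rw [setIntegral_eq_of_subset_of_forall_sdiff_eq_zero measurableSet_Iio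
    (Set.Iio_subset_Iio ht)]
  · refine setIntegral_congr_fun measurableSet_Iio fun r hr => ?_
    have hr' : r < t := lt_of_lt_of_le hr ht
    simp only [hgrad r hr']
  · rintro r ⟨hr, hr8⟩
    have hr8 : -8 ≤ r := not_lt.1 hr8
    have h0 : ∀ θ, (fun y => f r y θ) = fun _ => 0 := fun θ => funext fun y => hz r y θ hr8
    have hg0 : ∀ θ, gradHeatNormSq d (t - r) (fun y => f r y θ) x = 0 := fun θ => by
      rw [hgrad r hr, h0, heatGrad_zero, norm_zero, zero_pow two_ne_zero]
    simp only [hg0]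
    rw [Real.zero_rpow (by positivity), integral_zero, Real.zero_rpow (by positivity)]

lemma measure_cubeQ0_lt_top (d : ℕ) : volume (cubeQ0 d) < ∞ := by
  refine Bornology.IsBounded.measure_lt_top ?_
  refine (Metric.isBounded_Icc _ _).prod
    (isBounded_iff_forall_norm_le.2 ⟨Real.sqrt d, fun x hx => ?_⟩)
  refine Real.le_sqrt_of_sq_le ?_
  rw [EuclideanSpace.norm_sq_eq]
  calc ∑ j, ‖x j‖ ^ 2 ≤ ∑ _j : Fin d, (1 : ℝ) := Finset.sum_le_sum fun j _ => by
        rw [Real.norm_eq_abs, sq_abs]; nlinarith [(hx j).1, (hx j).2]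
    _ = d := by simp

lemma norm_sub_sq_le_of_mem_cube {d : ℕ} {x y : EuclideanSpace ℝ (Fin d)}
    (hx : ∀ j, x j ∈ Set.Icc (-1 : ℝ) 1) (hy : ∀ j, y j ∈ Set.Icc (-1 : ℝ) 1) :
    ‖y - x‖ ^ 2 ≤ 4 * d := by
  rw [EuclideanSpace.norm_sq_eq]
  calc ∑ j, ‖(y - x) j‖ ^ 2 ≤ ∑ _j : Fin d, (4 : ℝ) := Finset.sum_le_sum fun j _ => by
        rw [Real.norm_eq_abs, sq_abs, PiLp.sub_apply]
        nlinarith [(hx j).1, (hx j).2, (hy j).1, (hy j).2]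
    _ = 4 * d := by simp [mul_comm]

/-- If `f(t,x,θ) = 0` for `t ≥ -8`, then for every `(t,x) ∈ Q₀`,
`∫_{Q₀} |𝒢f(s,y) - 𝒢f(t,x)|² ds dy ≤ N 𝕄_t[F_f(·,x)](t)`, with `N = N(d)`. -/
theorem calG_oscillation_bound (d : ℕ) (hd : 1 ≤ d) :
    ∃ N : ℝ, 0 < N ∧
      ∀ (V : Type) [NormedAddCommGroup V] [InnerProductSpace ℝ V] [CompleteSpace V]
        [TopologicalSpace.SeparableSpace V]
        (H : ℝ), H ∈ Set.Ioo (1/2 : ℝ) 1 →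
      ∀ (α β : EReal), α < β →
      ∀ (f : ℝ → EuclideanSpace ℝ (Fin d) → ℝ → V),
        StronglyMeasurable
          (fun q : ℝ × EuclideanSpace ℝ (Fin d) × ℝ => f q.1 q.2.1 q.2.2) →
        (∀ θ, ContDiff ℝ (⊤ : ℕ∞)
          (fun q : ℝ × EuclideanSpace ℝ (Fin d) => f q.1 q.2 θ)) →
        (∃ K : Set (ℝ × EuclideanSpace ℝ (Fin d)), IsCompact K ∧
          ∀ θ, tsupport (fun q : ℝ × EuclideanSpace ℝ (Fin d) => f q.1 q.2 θ) ⊆ K) →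
        (∀ (t : ℝ) (x : EuclideanSpace ℝ (Fin d)) (θ : ℝ),
          (-8 : ℝ) ≤ t → f t x θ = 0) →
        ∀ (t : ℝ) (x : EuclideanSpace ℝ (Fin d)), (t, x) ∈ cubeQ0 d →
        ENNReal.ofReal
            (∫ q in cubeQ0 d, (calG d H α β f q.1 q.2 - calG d H α β f t x)^2) ≤
          ENNReal.ofReal N * maxT (fun s => Ff d H α β f s x) t := by
  set C₀ : ℝ := d * ((256 * (2 : ℝ) ^ ((d : ℝ) / 2) * Real.exp d) ^ 2 * (16 * Real.pi) ^ d)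
    with hC₀def
  set C₁ : ℝ := d * ((2 * (10 * d + 10) * (256 * (2 : ℝ) ^ ((d : ℝ) / 2) * Real.exp d)) ^ 2 *
    (16 * Real.pi) ^ d) with hC₁def
  have hC₀ : 0 ≤ C₀ := by positivity
  have hC₁ : 0 ≤ C₁ := by positivity
  refine ⟨2 * C₁ * volume.real (cubeQ0 d) + 1, by positivity, ?_⟩
  intro V _ _ _ _ H hH α β _ f hf hsmooth hsupp hz t x htx
  obtain ⟨K, hK, hKf⟩ := hsupp
  have hH0 : 0 < H := by linarith [hH.1]
  have hzero : ∀ r y θ, (r, y) ∉ K → f r y θ = 0 := fun r y θ hry =>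
    image_eq_zero_of_notMem_tsupport
      (f := fun q : ℝ × EuclideanSpace ℝ (Fin d) => f q.1 q.2 θ) (x := (r, y))
      fun h => hry (hKf θ h)
  have hc : ∀ r θ, Continuous fun y => f r y θ := fun r θ =>
    (hsmooth θ).continuous.comp (continuous_const.prodMk continuous_id)
  have hs : ∀ r θ, HasCompactSupport fun y => f r y θ := fun r θ =>
    HasCompactSupport.intro (hK.image continuous_snd) fun y hy =>
      hzero r y θ fun h => hy ⟨(r, y), h, rfl⟩
  obtain ⟨R, hR⟩ := hK.isBounded.exists_norm_le
  rcases eq_or_ne (maxT (fun s => Ff d H α β f s x) t) ∞ with hM | hM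
  · rw [hM, ENNReal.mul_top (by rw [Ne, ENNReal.ofReal_eq_zero, not_le]; positivity)]
    exact le_top
  set M := maxT (fun s => Ff d H α β f s x) t with hMdef
  set μ : Measure ℝ := volume.restrict {θ : ℝ | α < (θ : EReal) ∧ (θ : EReal) < β} with hμ
  set a : ℝ × EuclideanSpace ℝ (Fin d) → ℝ → ℝ → ℝ≥0∞ := fun q r θ =>
    ‖heatGrad d (q.1 - r) (fun y => f r y θ) q.2‖ₑ with ha
  have ham : ∀ q, Measurable (Function.uncurry (a q)) := fun q => by
    have := (measurable_norm_heatGrad hf q.1 q.2).ennreal_ofReal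
    simp only [ofReal_norm] at this
    exact this
  set E : ℝ × EuclideanSpace ℝ (Fin d) → ℝ≥0∞ := fun q =>
    mixedNorm H μ (volume.restrict (Set.Iio (-8))) (a q) with hE
  have hbase : E (t, x) ≠ ∞ := by
    have hsq : E (t, x) ^ 2 ≤ ENNReal.ofReal (2 * (C₀ * R ^ 2)) * M := by
      refine (mixedNorm_sq_le hH0 measurableSet_Iio
        (m := fun r θ => maxX d (fun y => ‖f r y θ‖ ^ 2) x)
        (K := fun r => ENNReal.ofReal (C₀ * R ^ 2 / r ^ 2)) (fun _ => ENNReal.ofReal_ne_top)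
        fun r hr θ => ?_).trans (lintegral_div_sq_mul_le_maxT _ (by positivity) htx.1)
      have hr : r < -8 := hr
      by_cases hrR : |r| ≤ R
      · refine (enorm_heatGrad_sq_le (hc r θ) x (ρ := -r) (by linarith) ?_ ?_).trans ?_
        · linarith [htx.1.1]
        · linarith [htx.1.2]
        · gcongr
          rw [le_div_iff₀ (by nlinarith)]
          have : r ^ 2 ≤ R ^ 2 := sq_le_sq' (by linarith [neg_abs_le r]) ((le_abs_self r).trans hrR)
          gcongr
      · have h0 : (fun y => f r y θ) = fun _ => 0 := funext fun y => hzero r y θ fun h =>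
          hrR ((norm_fst_le (r, y)).trans (hR _ h))
        simp [ha, h0, heatGrad_zero]
    intro hc
    rw [hc, ENNReal.top_pow two_ne_zero] at hsq
    exact (ENNReal.mul_ne_top ENNReal.ofReal_ne_top hM) (top_le_iff.1 hsq)
  have hosc : ∀ q ∈ cubeQ0 d,
      (calG d H α β f q.1 q.2 - calG d H α β f t x) ^ 2 ≤ 2 * C₁ * M.toReal := by
    intro q hq
    set D := mixedNorm H μ (volume.restrict (Set.Iio (-8))) (fun r θ =>
      ‖heatGrad d (q.1 - r) (fun y => f r y θ) q.2 - heatGrad d (t - r) (fun y => f r y θ) x‖ₑ)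
      with hD
    have hDsq : D ^ 2 ≤ ENNReal.ofReal (2 * C₁) * M := by
      refine (mixedNorm_sq_le hH0 measurableSet_Iio
        (m := fun r θ => maxX d (fun y => ‖f r y θ‖ ^ 2) x)
        (K := fun r => ENNReal.ofReal (C₁ / r ^ 2)) (fun _ => ENNReal.ofReal_ne_top)
        fun r hr θ => ?_).trans (lintegral_div_sq_mul_le_maxT _ hC₁ htx.1)
      have hr : r < -8 := hr
      obtain ⟨ht1, ht2⟩ := htx.1
      obtain ⟨hq1, hq2⟩ := hq.1
      have := enorm_heatGrad_sub_sq_le (hc r θ) (hs r θ)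
        (norm_sub_sq_le_of_mem_cube htx.2 hq.2) (ρ := -r) (τ := t - r) (σ := q.1 - r)
        (by linarith) (by linarith) (by linarith) (by linarith) (by linarith)
        (abs_le.2 ⟨by linarith, by linarith⟩)
      rwa [neg_sq] at this
    have hDtop : D ≠ ∞ := by
      intro hc
      rw [hc, ENNReal.top_pow two_ne_zero] at hDsq
      exact (ENNReal.mul_ne_top ENNReal.ofReal_ne_top hM) (top_le_iff.1 hDsq)
    have hstep : ∀ p p', (∀ r θ, a p r θ - a p' r θ ≤
        ‖heatGrad d (q.1 - r) (fun y => f r y θ) q.2 - heatGrad d (t - r) (fun y => f r y θ) x‖ₑ) →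
        E p ≤ E p' + D := by
      intro p p' h
      calc E p ≤ mixedNorm H μ (volume.restrict (Set.Iio (-8)))
            (fun r θ => a p' r θ + (a p r θ - a p' r θ)) :=
            mixedNorm_mono hH0 fun r θ => le_add_tsub
        _ ≤ E p' + mixedNorm H μ (volume.restrict (Set.Iio (-8)))
              (fun r θ => a p r θ - a p' r θ) :=
            mixedNorm_add_le hH0 hH.2.le (ham p') ((ham p).sub (ham p'))
        _ ≤ E p' + D := by gcongr; exact mixedNorm_mono hH0 h
    have h1 : E q ≤ E (t, x) + D := hstep _ _ fun r θ => by
      rw [tsub_le_iff_right]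
      simpa using enorm_add_le (heatGrad d (q.1 - r) (fun y => f r y θ) q.2 -
        heatGrad d (t - r) (fun y => f r y θ) x) (heatGrad d (t - r) (fun y => f r y θ) x)
    have h2 : E (t, x) ≤ E q + D := hstep _ _ fun r θ => by
      rw [tsub_le_iff_right, enorm_sub_rev]
      simpa using enorm_add_le (heatGrad d (t - r) (fun y => f r y θ) x -
        heatGrad d (q.1 - r) (fun y => f r y θ) q.2) (heatGrad d (q.1 - r) (fun y => f r y θ) q.2)
    have hqtop : E q ≠ ∞ := ne_top_of_le_ne_top (ENNReal.add_ne_top.2 ⟨hbase, hDtop⟩) h1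
    rw [calG_eq_toReal_mixedNorm hH0 α β hf hc hs hz (by linarith [hq.1.1]) q.2 hqtop,
      calG_eq_toReal_mixedNorm hH0 α β hf hc hs hz (by linarith [htx.1.1]) x hbase]
    have h1' := ENNReal.toReal_mono (ENNReal.add_ne_top.2 ⟨hbase, hDtop⟩) h1
    have h2' := ENNReal.toReal_mono (ENNReal.add_ne_top.2 ⟨hqtop, hDtop⟩) h2
    rw [ENNReal.toReal_add hbase hDtop] at h1'
    rw [ENNReal.toReal_add hqtop hDtop] at h2'
    have hD' := ENNReal.toReal_mono (ENNReal.mul_ne_top ENNReal.ofReal_ne_top hM) hDsq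
    rw [ENNReal.toReal_pow, ENNReal.toReal_mul, ENNReal.toReal_ofReal (by positivity)] at hD'
    exact (sq_le_sq' (by linarith) (by linarith)).trans hD'
  have hint := norm_setIntegral_le_of_norm_le_const (measure_cubeQ0_lt_top d)
    (f := fun q => (calG d H α β f q.1 q.2 - calG d H α β f t x) ^ 2)
    (C := 2 * C₁ * M.toReal) fun q hq => by
      rw [Real.norm_of_nonneg (sq_nonneg _)]; exact hosc q hq
  calc ENNReal.ofReal (∫ q in cubeQ0 d, (calG d H α β f q.1 q.2 - calG d H α β f t x) ^ 2)
      ≤ ENNReal.ofReal ((2 * C₁ * volume.real (cubeQ0 d) + 1) * M.toReal) := by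
        refine ENNReal.ofReal_le_ofReal ((le_abs_self _).trans (hint.trans ?_))
        nlinarith [ENNReal.toReal_nonneg (a := M)]
    _ = ENNReal.ofReal (2 * C₁ * volume.real (cubeQ0 d) + 1) * M := by
        rw [ENNReal.ofReal_mul (by positivity), ENNReal.ofReal_toReal hM]
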